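/- Let m be a universal probability and q a right-computable real number with q ≥ 1. Then ∑_{s∈{0,1}*} m(s)^q converges to a left-computable real number that is weakly Chaitin 1/q-random, i.e., there exists c ∈ ℕ such that K(α_n) ≥ n/q - c for all n, where α is the binary expansion of the sum mod 1. -/

import Mathlib

open Filter Topology

namespace Paper

/-- Finite binary strings. -/
abbrev Str := List Bool

/-- A computer: a partial recursive function on binary strings with prefix-free domain. -/
structure Computer where
  f : Str →. Str
  partrec : Partrec f
  prefixFree : ∀ p q : Str, (f p).Dom → (f q).Dom → p <+: q → p = q

/-- An optimal computer (universal self-delimiting Turing machine). -/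
structure OptimalComputer extends Computer where
  optimal : ∀ C : Computer, ∃ sim : ℕ, ∀ p s, s ∈ C.f p →
    ∃ p', s ∈ toComputer.f p' ∧ p'.length ≤ p.length + sim

/-- Prefix-free Kolmogorov complexity (program-size complexity) w.r.t. `U`. -/
noncomputable def Kc (U : OptimalComputer) (s : Str) : ℕ :=
  sInf {n | ∃ p : Str, p.length = n ∧ s ∈ U.f p}

/-- A semi-measure on binary strings: values in [0,1] with all finite partial sums ≤ 1. -/
def SemiMeasure (r : Str → ℝ) : Prop :=
  (∀ s, 0 ≤ r s ∧ r s ≤ 1) ∧ ∀ F : Finset Str, ∑ s ∈ F, r s ≤ 1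

/-- Lower-computability: approximability from below by a total recursive rational function. -/
def LowerComputable (r : Str → ℝ) : Prop :=
  ∃ f : ℕ → Str → ℚ, Computable₂ f ∧
    ∀ s : Str, (∀ n : ℕ, 0 ≤ f n s ∧ (f n s : ℝ) ≤ r s) ∧
      Tendsto (fun n => (f n s : ℝ)) atTop (nhds (r s))

/-- A lower-computable semi-measure. -/
def LCSemiMeasure (r : Str → ℝ) : Prop := SemiMeasure r ∧ LowerComputable r

/-- A universal probability: a lower-computable semi-measure dominating all
lower-computable semi-measures up to a positive multiplicative constant. -/
def UniversalProb (m : Str → ℝ) : Prop :=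
  LCSemiMeasure m ∧ ∀ r : Str → ℝ, LCSemiMeasure r → ∃ c : ℝ, 0 < c ∧ ∀ s, c * r s ≤ m s

/-- The first `n` bits of the base-two expansion of `T mod 1`
(the expansion with infinitely many zeros). -/
noncomputable def binPrefix (T : ℝ) (n : ℕ) : Str :=
  (List.range n).map (fun i => decide (⌊Int.fract T * 2 ^ (i + 1)⌋ % 2 = 1))

/-- A real is right-computable if it is the limit from above of a recursive
sequence of rationals. -/
def RightComputableReal (T : ℝ) : Prop :=
  ∃ g : ℕ → ℚ, Computable g ∧ (∀ n, T ≤ (g n : ℝ)) ∧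
    Tendsto (fun n => (g n : ℝ)) atTop (nhds T)

/-- A real is left-computable if its negation is right-computable. -/
def LeftComputableReal (T : ℝ) : Prop := RightComputableReal (-T)

/-- A computable real number. -/
def ComputableReal (T : ℝ) : Prop :=
  ∃ f : ℕ → ℚ, Computable f ∧ ∀ n : ℕ, |T - (f n : ℝ)| < (2 : ℝ)⁻¹ ^ n

/-- A recursively enumerable set of binary strings. -/
def REset (A : Set Str) : Prop :=
  ∃ g : Str →. Unit, Partrec g ∧ ∀ s, (g s).Dom ↔ s ∈ A

/-- `T` is weakly Chaitin `D`-random. -/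
noncomputable def WeaklyChaitinDRandom (U : OptimalComputer) (D T : ℝ) : Prop :=
  ∃ c : ℕ, ∀ n : ℕ, D * n - c ≤ Kc U (binPrefix T n)

/-- `T` is `D`-compressible. -/
noncomputable def DCompressible (U : OptimalComputer) (D T : ℝ) : Prop :=
  Filter.atTop.limsup (fun n : ℕ => (Kc U (binPrefix T n) : ℝ) / n) ≤ D



section RatCoding
open Encodable

/-- The auxiliary (non-surjective) code of a rational. -/
def ratCode (q : ℚ) : ℕ := Nat.pair (encode q.num) q.den

/-- Being the auxiliary code of a rational. -/
def IsRatCode (x : ℕ) : Prop :=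
  0 < x.unpair.2 ∧ Nat.gcd ((x.unpair.1 + 1) / 2) x.unpair.2 = 1

instance : DecidablePred IsRatCode := fun x => by unfold IsRatCode; infer_instance

theorem encode_int_natAbs (n : ℤ) : (encode n + 1) / 2 = n.natAbs := by
  cases n with
  | ofNat n => show (2 * n + 1) / 2 = n; omega
  | negSucc n => show (2 * n + 1 + 1) / 2 = n + 1; omega

theorem mem_range_ratCode (x : ℕ) : x ∈ Set.range ratCode ↔ IsRatCode x := by
  constructor
  · rintro ⟨q, rfl⟩
    simp only [IsRatCode, ratCode, Nat.unpair_pair, encode_int_natAbs]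
    exact ⟨q.pos, q.reduced⟩
  · rintro ⟨h1, h2⟩
    refine ⟨⟨Denumerable.ofNat ℤ x.unpair.1, x.unpair.2, h1.ne', ?_⟩, ?_⟩
    · rw [← encode_int_natAbs, Denumerable.encode_ofNat]; exact h2
    · have : encode (Denumerable.ofNat ℤ x.unpair.1) = x.unpair.1 := Denumerable.encode_ofNat _
      show Nat.pair (encode (Denumerable.ofNat ℤ x.unpair.1)) x.unpair.2 = x
      rw [this, Nat.pair_unpair]

theorem encode_rat (q : ℚ) :
    @encode ℚ (Primcodable.ofDenumerable ℚ).toEncodable q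
      = (List.range (ratCode q)).countP (fun y => decide (IsRatCode y)) := by
  have h : @encode ℚ (Primcodable.ofDenumerable ℚ).toEncodable q
    = (List.range (ratCode q)).countP
      (fun y => @decide (y ∈ Set.range (@encode ℚ Rat.instEncodable))
        (@Encodable.decidableRangeEncode ℚ Rat.instEncodable y)) := rfl
  rw [h]
  congr 1
  funext y
  have : (y ∈ Set.range (@encode ℚ Rat.instEncodable)) ↔ IsRatCode y := mem_range_ratCode y
  simp only [this]

theorem primrec_gcd : Primrec₂ (fun a b : ℕ => Nat.gcd a (b + 1)) := by
  have h : Primrec (fun p : ℕ × ℕ => Nat.findGreatest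
      (fun d => p.1 % d = 0 ∧ (p.2 + 1) % d = 0) (p.2 + 1)) := by
    refine Primrec.nat_findGreatest (p := fun (p : ℕ × ℕ) d => p.1 % d = 0 ∧ (p.2 + 1) % d = 0)
      (Primrec.succ.comp Primrec.snd) ?_
    apply PrimrecPred.primrecRel (p := fun (x : (ℕ × ℕ) × ℕ) =>
      x.1.1 % x.2 = 0 ∧ (x.1.2 + 1) % x.2 = 0)
    apply PrimrecPred.and
    · exact Primrec.eq.comp (Primrec.nat_mod.comp (Primrec.fst.comp Primrec.fst) Primrec.snd)
        (Primrec.const 0)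
    · exact Primrec.eq.comp (Primrec.nat_mod.comp (Primrec.succ.comp
        (Primrec.snd.comp Primrec.fst)) Primrec.snd) (Primrec.const 0)
  refine Primrec.of_eq h ?_
  rintro ⟨a, b⟩
  simp only
  rw [Nat.findGreatest_eq_iff]
  refine ⟨Nat.gcd_le_right _ (Nat.succ_pos _), fun _ => ⟨Nat.mod_eq_zero_of_dvd
    (Nat.gcd_dvd_left _ _), Nat.mod_eq_zero_of_dvd (Nat.gcd_dvd_right _ _)⟩, ?_⟩
  rintro n hn - ⟨h1, h2⟩
  have := Nat.le_of_dvd (Nat.gcd_pos_of_pos_right a (Nat.succ_pos b))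
    (Nat.dvd_gcd (Nat.dvd_of_mod_eq_zero h1) (Nat.dvd_of_mod_eq_zero h2))
  exact absurd hn (not_lt.2 this)

theorem primrecPred_isRatCode : PrimrecPred IsRatCode := by
  have h : PrimrecPred (fun x : ℕ => 0 < x.unpair.2 ∧
      Nat.gcd ((x.unpair.1 + 1) / 2) ((x.unpair.2 - 1) + 1) = 1) := by
    apply PrimrecPred.and
    · exact Primrec.nat_lt.comp (Primrec.const 0) (Primrec.snd.comp Primrec.unpair)
    · refine Primrec.eq.comp (primrec_gcd.comp ?_ ?_) (Primrec.const 1)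
      · exact Primrec.nat_div.comp (Primrec.succ.comp (Primrec.fst.comp Primrec.unpair))
          (Primrec.const 2)
      · exact Primrec.nat_sub.comp (Primrec.snd.comp Primrec.unpair) (Primrec.const 1)
  refine h.of_eq fun x => ?_
  unfold IsRatCode
  refine and_congr_right fun hx => ?_
  rw [Nat.sub_add_cancel hx]

/-- Counting auxiliary codes below a bound. -/
def ratRank (x : ℕ) : ℕ := (List.range x).countP (fun y => decide (IsRatCode y))

theorem primrec_ratRank : Primrec ratRank := by
  have h : Primrec (fun x : ℕ => ((List.range x).filter (fun y => decide (IsRatCode y))).length) :=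
    Primrec.list_length.comp ((Primrec.listFilter primrecPred_isRatCode).comp Primrec.list_range)
  refine h.of_eq fun x => ?_
  rw [ratRank, List.countP_eq_length_filter]

theorem encode_rat' (q : ℚ) :
    @encode ℚ (Primcodable.ofDenumerable ℚ).toEncodable q = ratRank (ratCode q) := encode_rat q

theorem ratCode_injective : Function.Injective ratCode := by
  intro a b h
  simp only [ratCode, Nat.pair_eq_pair] at h
  exact Rat.ext (encode_injective h.1) h.2

theorem computable_ratCode : Computable ratCode := by
  have h : Partrec (fun q : ℚ => Nat.rfind (fun x => Part.some
      (decide (IsRatCode x ∧ ratRank x = @encode ℚ (Primcodable.ofDenumerable ℚ).toEncodable q)))) := by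
    apply Partrec.rfind
    apply Computable.partrec
    apply Primrec.to_comp
    have : PrimrecPred (fun p : ℚ × ℕ => IsRatCode p.2 ∧
        ratRank p.2 = @encode ℚ (Primcodable.ofDenumerable ℚ).toEncodable p.1) :=
      (primrecPred_isRatCode.comp Primrec.snd).and
        (Primrec.eq.comp (primrec_ratRank.comp Primrec.snd) (Primrec.encode.comp Primrec.fst))
    exact this.decide
  refine h.of_eq_tot fun q => ?_
  have hex : ∀ x, (IsRatCode x ∧
      ratRank x = @encode ℚ (Primcodable.ofDenumerable ℚ).toEncodable q) ↔ x = ratCode q := by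
    intro x
    constructor
    · rintro ⟨h1, h2⟩
      obtain ⟨q', rfl⟩ := (mem_range_ratCode x).2 h1
      rw [← encode_rat'] at h2
      rw [@encode_injective ℚ (Primcodable.ofDenumerable ℚ).toEncodable _ _ h2]
    · rintro rfl
      exact ⟨(mem_range_ratCode _).1 ⟨q, rfl⟩, (encode_rat' q).symm⟩
  refine Nat.mem_rfind.2 ⟨?_, fun {m} hm => ?_⟩
  · simp [hex]
  · have : m ≠ ratCode q := hm.ne
    simp [hex, this]

theorem computable_ratNum : Computable (fun q : ℚ => q.num.natAbs) := by
  have h : Primrec (fun x : ℕ => (x.unpair.1 + 1) / 2) :=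
    Primrec.nat_div.comp (Primrec.succ.comp (Primrec.fst.comp Primrec.unpair)) (Primrec.const 2)
  refine (h.to_comp.comp computable_ratCode).of_eq fun q => ?_
  simp [ratCode, encode_int_natAbs]

theorem computable_ratDen : Computable (fun q : ℚ => q.den) := by
  have h : Primrec (fun x : ℕ => x.unpair.2) := Primrec.snd.comp Primrec.unpair
  refine (h.to_comp.comp computable_ratCode).of_eq fun q => ?_
  simp [ratCode]

theorem primrec_gcd_left : Primrec₂ (fun a b : ℕ => a / Nat.gcd a (b + 1)) :=
  (Primrec.nat_div.comp Primrec.fst primrec_gcd)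

theorem primrec_gcd_right : Primrec₂ (fun a b : ℕ => (b + 1) / Nat.gcd a (b + 1)) :=
  (Primrec.nat_div.comp (Primrec.succ.comp Primrec.snd) primrec_gcd)

theorem gcd_facts (a b : ℕ) : 0 < (b + 1) / Nat.gcd a (b + 1) ∧
    Nat.Coprime (a / Nat.gcd a (b + 1)) ((b + 1) / Nat.gcd a (b + 1)) ∧
    (a : ℚ) / ((b + 1 : ℕ) : ℚ) = (((a / Nat.gcd a (b + 1) : ℕ) : ℤ) : ℚ) /
      ((((b + 1) / Nat.gcd a (b + 1) : ℕ) : ℤ) : ℚ) := by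
  have hg : 0 < Nat.gcd a (b + 1) := Nat.gcd_pos_of_pos_right a (Nat.succ_pos b)
  have hb : 0 < (b + 1) / Nat.gcd a (b + 1) :=
    Nat.div_pos (Nat.gcd_le_right _ (Nat.succ_pos _)) hg
  refine ⟨hb, Nat.coprime_div_gcd_div_gcd hg, ?_⟩
  have h1 : (((a / Nat.gcd a (b + 1) * Nat.gcd a (b + 1) : ℕ)) : ℚ) = a := by
    rw [Nat.div_mul_cancel (Nat.gcd_dvd_left _ _)]
  have h2 : ((((b + 1) / Nat.gcd a (b + 1) * Nat.gcd a (b + 1) : ℕ)) : ℚ) = ((b + 1 : ℕ) : ℚ) := by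
    rw [Nat.div_mul_cancel (Nat.gcd_dvd_right _ _)]
  rw [← h1, ← h2]
  have hg' : ((Nat.gcd a (b + 1) : ℕ) : ℚ) ≠ 0 := by exact_mod_cast hg.ne'
  rw [Nat.cast_mul, Nat.cast_mul, mul_div_mul_right _ _ hg']
  simp only [Int.cast_natCast]

theorem encode_int_nat (n : ℕ) : encode (n : ℤ) = 2 * n := rfl

theorem encode_int_neg (n : ℕ) : encode (-(n : ℤ)) = 2 * n - 1 := by
  cases n with
  | zero => rfl
  | succ n => rfl

theorem ratCode_div (a b : ℕ) : ratCode ((a : ℚ) / ((b + 1 : ℕ) : ℚ)) =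
    Nat.pair (2 * (a / Nat.gcd a (b + 1))) ((b + 1) / Nat.gcd a (b + 1)) := by
  obtain ⟨h1, h2, h3⟩ := gcd_facts a b
  rw [h3, ratCode, Rat.num_div_eq_of_coprime (by exact_mod_cast h1) (by exact h2),
    encode_int_nat]
  have := Rat.den_div_eq_of_coprime (a := ((a / Nat.gcd a (b + 1) : ℕ) : ℤ))
    (b := (((b + 1) / Nat.gcd a (b + 1) : ℕ) : ℤ)) (by exact_mod_cast h1) h2
  rw [Int.natCast_inj.1 this]

theorem ratCode_neg_div (a b : ℕ) : ratCode (-((a : ℚ) / ((b + 1 : ℕ) : ℚ))) =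
    Nat.pair (2 * (a / Nat.gcd a (b + 1)) - 1) ((b + 1) / Nat.gcd a (b + 1)) := by
  obtain ⟨h1, h2, h3⟩ := gcd_facts a b
  rw [h3, ratCode, Rat.neg_num, Rat.neg_den,
    Rat.num_div_eq_of_coprime (by exact_mod_cast h1) (by exact h2),
    encode_int_neg]
  have := Rat.den_div_eq_of_coprime (a := ((a / Nat.gcd a (b + 1) : ℕ) : ℤ))
    (b := (((b + 1) / Nat.gcd a (b + 1) : ℕ) : ℤ)) (by exact_mod_cast h1) h2
  rw [Int.natCast_inj.1 this]

theorem computable_ratDiv : Computable₂ (fun a b : ℕ => (a : ℚ) / ((b + 1 : ℕ) : ℚ)) := by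
  apply Computable.encode_iff.1
  have h : Primrec (fun p : ℕ × ℕ => ratRank (Nat.pair (2 * (p.1 / Nat.gcd p.1 (p.2 + 1)))
      ((p.2 + 1) / Nat.gcd p.1 (p.2 + 1)))) :=
    primrec_ratRank.comp (Primrec₂.natPair.comp
      (Primrec.nat_mul.comp (Primrec.const 2) primrec_gcd_left) primrec_gcd_right)
  refine h.to_comp.of_eq fun p => ?_
  rw [← ratCode_div, ← encode_rat']

theorem computable_ratNegDiv : Computable₂ (fun a b : ℕ => -((a : ℚ) / ((b + 1 : ℕ) : ℚ))) := by
  apply Computable.encode_iff.1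
  have h : Primrec (fun p : ℕ × ℕ => ratRank (Nat.pair (2 * (p.1 / Nat.gcd p.1 (p.2 + 1)) - 1)
      ((p.2 + 1) / Nat.gcd p.1 (p.2 + 1)))) :=
    primrec_ratRank.comp (Primrec₂.natPair.comp
      (Primrec.nat_sub.comp
      (Primrec.nat_mul.comp (Primrec.const 2) primrec_gcd_left) (Primrec.const 1)) primrec_gcd_right)
  refine h.to_comp.of_eq fun p => ?_
  rw [← ratCode_neg_div, ← encode_rat']

end RatCoding

section Aux
open Encodable

/-- Kraft's inequality for finite prefix-free sets of binary strings. -/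
theorem kraft_aux (L : ℕ) : ∀ S : Finset Str, (∀ p ∈ S, p.length ≤ L) →
    (∀ p ∈ S, ∀ q ∈ S, p <+: q → p = q) → ∑ p ∈ S, (2 : ℝ)⁻¹ ^ p.length ≤ 1 := by
  induction L with
  | zero =>
    intro S hS _
    have : S ⊆ {[]} := fun p hp => by
      have := hS p hp
      simpa using this
    calc ∑ p ∈ S, (2 : ℝ)⁻¹ ^ p.length ≤ ∑ p ∈ ({[]} : Finset Str), (2 : ℝ)⁻¹ ^ p.length :=
          Finset.sum_le_sum_of_subset_of_nonneg this (fun _ _ _ => by positivity)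
      _ ≤ 1 := by simp
  | succ L ih =>
    intro S hS hpf
    by_cases hnil : [] ∈ S
    · have : S ⊆ {[]} := fun p hp => by
        have := hpf [] hnil p hp List.nil_prefix
        simp [← this]
      calc ∑ p ∈ S, (2 : ℝ)⁻¹ ^ p.length ≤ ∑ p ∈ ({[]} : Finset Str), (2 : ℝ)⁻¹ ^ p.length :=
            Finset.sum_le_sum_of_subset_of_nonneg this (fun _ _ _ => by positivity)
        _ ≤ 1 := by simp
    · have hinj : ∀ b : Bool, Function.Injective (fun l : Str => b :: l) :=
        fun b x y h => (List.cons.inj h).2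
      let P : Bool → Finset Str := fun b => S.preimage (fun l => b :: l) ((hinj b).injOn)
      have hP : ∀ b, ∑ p ∈ P b, (2 : ℝ)⁻¹ ^ p.length ≤ 1 := by
        intro b
        apply ih
        · intro p hp
          have := hS _ (Finset.mem_preimage.1 hp)
          simpa using this
        · intro p hp q hq hpq
          have := hpf _ (Finset.mem_preimage.1 hp) _ (Finset.mem_preimage.1 hq)
            (by simpa using hpq)
          simpa using this
      have hsplit : S = (P true).map ⟨_, hinj true⟩ ∪ (P false).map ⟨_, hinj false⟩ := by
        ext p
        cases p with
        | nil => simp [hnil]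
        | cons b l => cases b <;> simp [P]
      have hle : ∑ p ∈ S, (2 : ℝ)⁻¹ ^ p.length ≤
          ∑ p ∈ (P true).map ⟨_, hinj true⟩, (2 : ℝ)⁻¹ ^ p.length +
          ∑ p ∈ (P false).map ⟨_, hinj false⟩, (2 : ℝ)⁻¹ ^ p.length := by
        conv_lhs => rw [hsplit]
        rw [← Finset.sum_union_inter]
        have : 0 ≤ ∑ p ∈ (P true).map ⟨_, hinj true⟩ ∩ (P false).map ⟨_, hinj false⟩,
          (2 : ℝ)⁻¹ ^ p.length := Finset.sum_nonneg fun _ _ => by positivity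
        linarith
      refine hle.trans ?_
      rw [Finset.sum_map, Finset.sum_map]
      simp only [Function.Embedding.coeFn_mk, List.length_cons, pow_succ]
      rw [← Finset.sum_mul, ← Finset.sum_mul]
      have h1 := hP true
      have h2 := hP false
      linarith

theorem kraft (S : Finset Str)
    (hpf : ∀ p ∈ S, ∀ q ∈ S, p <+: q → p = q) : ∑ p ∈ S, (2 : ℝ)⁻¹ ^ p.length ≤ 1 :=
  kraft_aux (S.sup List.length) S (fun _ hp => Finset.le_sup (f := List.length) hp) hpf

theorem computable_sum {α : Type*} [Primcodable α] {h : α → ℕ} {F : α → ℕ → ℕ}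
    (hh : Computable h) (hF : Computable₂ F) :
    Computable (fun a => ∑ i ∈ Finset.range (h a), F a i) := by
  have h1 : Computable (fun a => Nat.rec (motive := fun _ => ℕ) 0
      (fun i s => s + F a i) (h a)) := by
    refine Computable.nat_rec (h := fun a (p : ℕ × ℕ) => p.2 + F a p.1) hh (Computable.const 0) ?_
    exact Primrec.nat_add.to_comp.comp (Computable.snd.comp Computable.snd)
      (hF.comp Computable.fst (Computable.fst.comp Computable.snd))
  refine h1.of_eq fun a => ?_
  induction h a with
  | zero => simp
  | succ n ih => rw [Finset.sum_range_succ, ← ih]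

theorem primrec_pow : Primrec₂ (fun a b : ℕ => a ^ b) :=
  Primrec₂.unpaired'.1 Nat.Primrec.pow

/-- Integer part of `(n+1) * (x/y)^(a/b)` when `x ≤ y`. -/
def powApprox (n x y a b : ℕ) : ℕ :=
  Nat.findGreatest (fun j => j ^ b * y ^ a ≤ x ^ a * (n + 1) ^ b) (n + 1)

theorem primrec_powApprox : Primrec (fun p : ℕ × ℕ × ℕ × ℕ × ℕ =>
    powApprox p.1 p.2.1 p.2.2.1 p.2.2.2.1 p.2.2.2.2) := by
  unfold powApprox
  refine Primrec.nat_findGreatest (p := fun (p : ℕ × ℕ × ℕ × ℕ × ℕ) j =>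
    j ^ p.2.2.2.2 * p.2.2.1 ^ p.2.2.2.1 ≤ p.2.1 ^ p.2.2.2.1 * (p.1 + 1) ^ p.2.2.2.2)
    (Primrec.succ.comp Primrec.fst) ?_
  apply PrimrecPred.primrecRel (p := fun (z : (ℕ × ℕ × ℕ × ℕ × ℕ) × ℕ) =>
    z.2 ^ z.1.2.2.2.2 * z.1.2.2.1 ^ z.1.2.2.2.1 ≤ z.1.2.1 ^ z.1.2.2.2.1 * (z.1.1 + 1) ^ z.1.2.2.2.2)
  have e1 : Primrec (fun z : (ℕ × ℕ × ℕ × ℕ × ℕ) × ℕ => z.1.1) := Primrec.fst.comp Primrec.fst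
  have e2' : Primrec (fun z : (ℕ × ℕ × ℕ × ℕ × ℕ) × ℕ => z.1.2) := Primrec.snd.comp Primrec.fst
  have e2 : Primrec (fun z : (ℕ × ℕ × ℕ × ℕ × ℕ) × ℕ => z.1.2.1) := Primrec.fst.comp e2'
  have e3' : Primrec (fun z : (ℕ × ℕ × ℕ × ℕ × ℕ) × ℕ => z.1.2.2) := Primrec.snd.comp e2'
  have e3 : Primrec (fun z : (ℕ × ℕ × ℕ × ℕ × ℕ) × ℕ => z.1.2.2.1) := Primrec.fst.comp e3'
  have e4' : Primrec (fun z : (ℕ × ℕ × ℕ × ℕ × ℕ) × ℕ => z.1.2.2.2) := Primrec.snd.comp e3'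
  have e4 : Primrec (fun z : (ℕ × ℕ × ℕ × ℕ × ℕ) × ℕ => z.1.2.2.2.1) := Primrec.fst.comp e4'
  have e5 : Primrec (fun z : (ℕ × ℕ × ℕ × ℕ × ℕ) × ℕ => z.1.2.2.2.2) := Primrec.snd.comp e4'
  exact Primrec.nat_le.comp
    (Primrec.nat_mul.comp (primrec_pow.comp Primrec.snd e5) (primrec_pow.comp e3 e4))
    (Primrec.nat_mul.comp (primrec_pow.comp e2 e4) (primrec_pow.comp (Primrec.succ.comp e1) e5))

/-- Rational version of `powApprox`. -/
def ratPow (n : ℕ) (x y : ℚ) : ℕ := powApprox n x.num.natAbs x.den y.num.natAbs y.den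

theorem computable_ratPow : Computable (fun p : ℕ × ℚ × ℚ => ratPow p.1 p.2.1 p.2.2) := by
  have h1 : Computable (fun p : ℕ × ℚ × ℚ => p.2.1) := Computable.fst.comp Computable.snd
  have h2 : Computable (fun p : ℕ × ℚ × ℚ => p.2.2) := Computable.snd.comp Computable.snd
  have h : Computable (fun p : ℕ × ℚ × ℚ => (p.1, p.2.1.num.natAbs, p.2.1.den,
      p.2.2.num.natAbs, p.2.2.den)) :=
    Computable.fst.pair ((computable_ratNum.comp h1).pair
      ((computable_ratDen.comp h1).pair ((computable_ratNum.comp h2).pair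
        (computable_ratDen.comp h2))))
  have h3 := primrec_powApprox.to_comp.comp h
  refine h3.of_eq fun p => ?_
  rw [ratPow]

theorem pow_cond_iff (n j : ℕ) (x y : ℚ) (hx : 0 ≤ x) (hy : 0 < y) :
    j ^ y.den * x.den ^ y.num.natAbs ≤ x.num.natAbs ^ y.num.natAbs * (n + 1) ^ y.den ↔
      (j : ℝ) / (n + 1) ≤ (x : ℝ) ^ (y : ℝ) := by
  have hxd : (0 : ℝ) < x.den := by exact_mod_cast x.pos
  have hn : (0 : ℝ) < (n : ℝ) + 1 := by positivity
  have hyd : (0 : ℝ) < y.den := by exact_mod_cast y.pos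
  have hxe : (x : ℝ) = (x.num.natAbs : ℝ) / x.den := by
    conv_lhs => rw [← Rat.num_div_den x]
    have : ((x.num.natAbs : ℤ)) = x.num := Int.natAbs_of_nonneg (Rat.num_nonneg.2 hx)
    push_cast
    rw [← this]; simp
  have hye : (y : ℝ) = (y.num.natAbs : ℝ) / y.den := by
    conv_lhs => rw [← Rat.num_div_den y]
    have : ((y.num.natAbs : ℤ)) = y.num := Int.natAbs_of_nonneg (Rat.num_nonneg.2 hy.le)
    push_cast
    rw [← this]; simp
  have hx0 : (0 : ℝ) ≤ x := by exact_mod_cast hx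
  have key : ((x : ℝ) ^ (y : ℝ)) ^ y.den = (x : ℝ) ^ y.num.natAbs := by
    rw [← Real.rpow_natCast, ← Real.rpow_mul hx0, hye, div_mul_cancel₀ _ hyd.ne',
      Real.rpow_natCast]
  rw [← pow_le_pow_iff_left₀ (a := (j : ℝ) / (n + 1)) (by positivity) (by positivity) y.den_nz, key, hxe, div_pow, div_pow,
    div_le_div_iff₀ (by positivity) (by positivity)]
  norm_cast

theorem ratPow_le (n : ℕ) (x y : ℚ) (hx : 0 ≤ x) (hy : 0 < y) :
    (ratPow n x y : ℝ) / (n + 1) ≤ (x : ℝ) ^ (y : ℝ) := by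
  rw [← pow_cond_iff n _ x y hx hy, ratPow, powApprox]
  refine Nat.findGreatest_spec (P := fun j => j ^ y.den * x.den ^ y.num.natAbs ≤
    x.num.natAbs ^ y.num.natAbs * (n + 1) ^ y.den) (m := 0) (Nat.zero_le _) ?_
  simp [y.den_nz]

theorem lt_ratPow (n : ℕ) (x y : ℚ) (hx : 0 ≤ x) (hx1 : x ≤ 1) (hy : 0 < y) :
    (x : ℝ) ^ (y : ℝ) - 1 / (n + 1) < (ratPow n x y : ℝ) / (n + 1) := by
  have hn : (0 : ℝ) < (n : ℝ) + 1 := by positivity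
  by_contra hcon
  push Not at hcon
  have h1 : ((ratPow n x y + 1 : ℕ) : ℝ) / (n + 1) ≤ (x : ℝ) ^ (y : ℝ) := by
    push_cast
    rw [add_div]; linarith
  have hx0 : (0 : ℝ) ≤ x := by exact_mod_cast hx
  have hx1' : (x : ℝ) ≤ 1 := by exact_mod_cast hx1
  have hle : (x : ℝ) ^ (y : ℝ) ≤ 1 := Real.rpow_le_one hx0 hx1' (by exact_mod_cast hy.le)
  have h2 : ratPow n x y + 1 ≤ n + 1 := by
    have := h1.trans hle
    rw [div_le_one hn] at this
    exact_mod_cast this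
  rw [← pow_cond_iff n _ x y hx hy] at h1
  have := Nat.le_findGreatest (P := fun j => j ^ y.den * x.den ^ y.num.natAbs ≤
    x.num.natAbs ^ y.num.natAbs * (n + 1) ^ y.den) h2 h1
  have h3 : ratPow n x y + 1 ≤ ratPow n x y := this
  omega

end Aux

section Machine
open Encodable
open Nat.Partrec (Code)

/-- Strings with code below `n`. -/
noncomputable def strBelow (n : ℕ) : Finset Str :=
  (Finset.range n).preimage (encode : Str → ℕ) (encode_injective.injOn)

theorem mem_strBelow {n : ℕ} {s : Str} : s ∈ strBelow n ↔ encode s < n := by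
  simp [strBelow]

theorem decode₂_eq_none_of {i : ℕ} (h : i ∉ Set.range (encode : Str → ℕ)) :
    decode₂ Str i = none := by
  by_contra hc
  obtain ⟨s, hs⟩ := Option.ne_none_iff_exists'.1 hc
  exact h ⟨s, mem_decode₂.1 hs⟩

theorem decode₂_encode_str (s : Str) : decode₂ Str (encode s) = some s :=
  mem_decode₂.2 rfl

/-- Length of the string coded by `i`. -/
def lenCode (i : ℕ) : ℕ := ((decode₂ Str i).getD []).length

theorem lenCode_le (i : ℕ) : lenCode i ≤ i := by
  unfold lenCode
  cases h : decode₂ Str i with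
  | none => simp
  | some p =>
    have : encode p = i := mem_decode₂.1 h
    rw [← this]
    exact length_le_encode p

theorem primrec_lenCode : Primrec lenCode :=
  Primrec.list_length.comp (Primrec.option_getD.comp Primrec.decode₂ (Primrec.const []))

/-- Numerator of the stage-`n` approximation to the output semimeasure. -/
def massNum (c : Code) (n : ℕ) (s : Str) : ℕ :=
  ∑ i ∈ Finset.range n, if Code.evaln n c i = some (encode s) then 2 ^ (n - lenCode i) else 0

theorem computable_massNum (c : Code) : Computable (fun p : ℕ × Str => massNum c p.1 p.2) := by
  unfold massNum
  refine computable_sum (h := fun p : ℕ × Str => p.1) (F := fun (p : ℕ × Str) i =>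
    if Code.evaln p.1 c i = some (encode p.2) then 2 ^ (p.1 - lenCode i) else 0) Computable.fst ?_
  apply Primrec.to_comp
  have e1 : Primrec (fun z : (ℕ × Str) × ℕ => z.1.1) := Primrec.fst.comp Primrec.fst
  have e2 : Primrec (fun z : (ℕ × Str) × ℕ => z.1.2) := Primrec.snd.comp Primrec.fst
  have e3 : Primrec (fun z : (ℕ × Str) × ℕ => Code.evaln z.1.1 c z.2) :=
    Code.primrec_evaln.comp ((e1.pair (Primrec.const c)).pair Primrec.snd)
  refine Primrec.ite (c := fun z : (ℕ × Str) × ℕ => Code.evaln z.1.1 c z.2 = some (encode z.1.2))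
    ?_ ?_ (Primrec.const 0)
  · exact Primrec.eq.comp e3 (Primrec.option_some.comp (Primrec.encode.comp e2))
  · exact primrec_pow.comp (Primrec.const 2)
      (Primrec.nat_sub.comp e1 (primrec_lenCode.comp Primrec.snd))

/-- Rational stage-`n` approximation. -/
def massRat (c : Code) (n : ℕ) (s : Str) : ℚ := (massNum c n s : ℚ) / ((2 ^ n - 1 + 1 : ℕ) : ℚ)

theorem computable_massRat (c : Code) : Computable₂ (massRat c) := by
  have h : Primrec (fun p : ℕ × Str => 2 ^ p.1 - 1) :=
    Primrec.nat_sub.comp (primrec_pow.comp (Primrec.const 2) Primrec.fst) (Primrec.const 1)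
  exact computable_ratDiv.comp (computable_massNum c) h.to_comp

theorem massRat_cast (c : Code) (n : ℕ) (s : Str) (hc : ∀ i ∉ Set.range (encode : Str → ℕ),
      Code.evaln n c i ≠ some (encode s)) :
    (massRat c n s : ℝ) = ∑ p ∈ strBelow n,
      if Code.evaln n c (encode p) = some (encode s) then (2 : ℝ)⁻¹ ^ p.length else 0 := by
  have h1 : ∑ p ∈ strBelow n,
      (if Code.evaln n c (encode p) = some (encode s) then (2 : ℝ)⁻¹ ^ p.length else 0) =
      ∑ i ∈ Finset.range n,
      (if Code.evaln n c i = some (encode s) then (2 : ℝ)⁻¹ ^ lenCode i else 0) := by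
    rw [strBelow, ← Finset.sum_preimage (encode : Str → ℕ) (Finset.range n) encode_injective.injOn
      (fun i => if Code.evaln n c i = some (encode s) then (2 : ℝ)⁻¹ ^ lenCode i else 0)]
    · refine Finset.sum_congr rfl fun p _ => ?_
      simp [lenCode]
    · intro i _ hi
      rw [if_neg (hc i hi)]
  rw [h1, massRat, massNum, Nat.sub_add_cancel Nat.one_le_two_pow]
  push_cast
  rw [Finset.sum_div]
  refine Finset.sum_congr rfl fun i hi => ?_
  split_ifs
  · have : lenCode i ≤ n := (lenCode_le i).trans (Finset.mem_range.1 hi).le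
    have h2 : (2 : ℝ) ^ n = 2 ^ (n - lenCode i) * 2 ^ lenCode i := by
      rw [← pow_add, Nat.sub_add_cancel this]
    rw [h2, inv_pow, div_eq_iff (by positivity), mul_comm (_ ^ (n - lenCode i)),
      inv_mul_cancel_left₀ (by positivity)]
    push_cast
    rfl
  · simp

theorem exists_output_semimeasure (ψ : Str →. Str) (hψ : Partrec ψ)
    (hpf : ∀ p q : Str, (ψ p).Dom → (ψ q).Dom → p <+: q → p = q) :
    ∃ r : Str → ℝ, LCSemiMeasure r ∧ ∀ p s, s ∈ ψ p → (2 : ℝ)⁻¹ ^ p.length ≤ r s := by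
  classical
  obtain ⟨c, hc⟩ := Code.exists_code.1 (Partrec.bind_decode₂_iff.1 hψ)
  have hsound : ∀ n p s, Code.evaln n c (encode p) = some (encode s) → s ∈ ψ p := by
    intro n p s h
    have h' := Code.evaln_sound (k := n) (c := c) (n := encode p) (x := encode s) h
    rw [hc] at h'
    simp only [decode₂_encode_str, Part.coe_some, Part.bind_some, Part.mem_map_iff] at h'
    obtain ⟨a, ha, hae⟩ := h'
    rwa [← encode_injective hae]
  have hcomplete : ∀ p s, s ∈ ψ p → ∃ n, Code.evaln n c (encode p) = some (encode s) := by
    intro p s h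
    have : encode s ∈ c.eval (encode p) := by
      rw [hc]
      simp only [decode₂_encode_str, Part.coe_some, Part.bind_some]
      exact Part.mem_map _ h
    obtain ⟨n, hn⟩ := Code.evaln_complete.1 this
    exact ⟨n, hn⟩
  have hnone : ∀ (n : ℕ) (s : Str), ∀ i ∉ Set.range (encode : Str → ℕ), Code.evaln n c i ≠ some (encode s) := by
    intro n s i hi h
    have h' := Code.evaln_sound (k := n) (c := c) (n := i) (x := encode s) h
    rw [hc] at h'
    simp [decode₂_eq_none_of hi] at h'
  let a : ℕ → Str → ℝ := fun n s => ∑ p ∈ strBelow n,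
      if Code.evaln n c (encode p) = some (encode s) then (2 : ℝ)⁻¹ ^ p.length else 0
  have ha : ∀ n s, (massRat c n s : ℝ) = a n s := fun n s => massRat_cast c n s (hnone n s)
  have hterm : ∀ (n : ℕ) (p s : Str), (0 : ℝ) ≤
      if Code.evaln n c (encode p) = some (encode s) then (2 : ℝ)⁻¹ ^ p.length else 0 := by
    intro n p s
    split_ifs <;> positivity
  have ha0 : ∀ n s, 0 ≤ a n s := fun n s => Finset.sum_nonneg fun p _ => hterm n p s
  have hmono : ∀ s, Monotone (fun n => a n s) := by
    intro s n n' hnn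
    refine (Finset.sum_le_sum fun p _ => ?_).trans
      (Finset.sum_le_sum_of_subset_of_nonneg (t := strBelow n') ?_ fun p _ _ => hterm n' p s)
    · split_ifs with h1 h2
      · exact le_rfl
      · exact absurd (Code.evaln_mono hnn h1) h2
      · positivity
      · exact le_rfl
    · intro p hp
      rw [mem_strBelow] at hp ⊢
      omega
  have hsum : ∀ n (F : Finset Str), ∑ s ∈ F, a n s ≤ 1 := by
    intro n F
    rw [Finset.sum_comm]
    have h1 : ∀ p ∈ strBelow n, (∑ s ∈ F,
        if Code.evaln n c (encode p) = some (encode s) then (2 : ℝ)⁻¹ ^ p.length else 0) ≤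
        if (ψ p).Dom then (2 : ℝ)⁻¹ ^ p.length else 0 := by
      intro p _
      split_ifs with hd
      · calc _ ≤ ∑ s ∈ F, (if s = (ψ p).get hd then (2 : ℝ)⁻¹ ^ p.length else 0) := by
              refine Finset.sum_le_sum fun s _ => ?_
              split_ifs with h2 h3
              · exact le_rfl
              · exact absurd (Part.get_eq_of_mem (hsound n p s h2) hd).symm h3
              · positivity
              · exact le_rfl
          _ ≤ _ := by
              rw [Finset.sum_ite_eq']
              split_ifs
              · exact le_rfl
              · positivity
      · refine (Finset.sum_eq_zero fun s _ => ?_).le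
        rw [if_neg]
        intro h
        exact hd (Part.dom_iff_mem.2 ⟨s, hsound n p s h⟩)
    refine (Finset.sum_le_sum h1).trans ?_
    rw [← Finset.sum_filter]
    apply kraft
    intro p hp q hq hpq
    exact hpf p q (Finset.mem_filter.1 hp).2 (Finset.mem_filter.1 hq).2 hpq
  have ha1 : ∀ n s, a n s ≤ 1 := fun n s => by simpa using hsum n {s}
  have hbdd : ∀ s, BddAbove (Set.range fun n => a n s) := fun s =>
    ⟨1, by rintro _ ⟨n, rfl⟩; exact ha1 n s⟩
  have htend : ∀ s, Tendsto (fun n => a n s) atTop (𝓝 (⨆ n, a n s)) := fun s =>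
    tendsto_atTop_ciSup (hmono s) (hbdd s)
  have hle : ∀ n s, a n s ≤ ⨆ n, a n s := fun n s => le_ciSup (hbdd s) n
  refine ⟨fun s => ⨆ n, a n s, ⟨⟨fun s => ⟨(ha0 0 s).trans (hle 0 s), ciSup_le fun n => ha1 n s⟩,
    fun F => ?_⟩, ⟨massRat c, computable_massRat c, fun s => ⟨fun n => ⟨?_, ?_⟩, ?_⟩⟩⟩, ?_⟩
  · exact le_of_tendsto' (tendsto_finsetSum F fun s _ => htend s) fun n => hsum n F
  · have := ha0 n s
    rw [← ha] at this
    exact_mod_cast this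
  · rw [ha]; exact hle n s
  · simp only [ha]; exact htend s
  · intro p s hs
    obtain ⟨n, hn⟩ := hcomplete p s hs
    refine le_trans ?_ (hle n s)
    have hp : p ∈ strBelow n := mem_strBelow.2 (Code.evaln_bound hn)
    have := Finset.single_le_sum (f := fun p => if Code.evaln n c (encode p) = some (encode s) then
      (2 : ℝ)⁻¹ ^ p.length else 0) (fun p _ => hterm n p s) hp
    simp only [if_pos hn] at this
    exact this

theorem Kc_attained (U : OptimalComputer) (s : Str) :
    ∃ p : Str, p.length = Kc U s ∧ s ∈ U.f p := by
  have hne : {n | ∃ p : Str, p.length = n ∧ s ∈ U.f p}.Nonempty := by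
    let C : Computer :=
      { f := fun p => ((if p = [] then some s else none : Option Str) : Part Str)
        partrec := by
          apply Computable.ofOption
          apply Primrec.to_comp
          exact Primrec.ite (Primrec.eq.comp Primrec.id (Primrec.const [])) (Primrec.const _)
            (Primrec.const _)
        prefixFree := by
          intro p q hp hq _
          have key : ∀ p : Str,
              (((if p = [] then some s else none : Option Str) : Part Str)).Dom → p = [] := by
            intro p hp
            by_contra h
            simp [h] at hp
          rw [key p hp, key q hq] }
    obtain ⟨k, hk⟩ := U.optimal C
    obtain ⟨p', hp', -⟩ := hk [] s (by simp [C])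
    exact ⟨_, p', rfl, hp'⟩
  exact Nat.sInf_mem hne

end Machine

section Main
open Encodable

/-- Value of a binary string. -/
def strVal (w : Str) : ℕ := w.foldl (fun a b => 2 * a + b.toNat) 0

theorem primrec_strVal : Primrec strVal := by
  unfold strVal
  refine Primrec.list_foldl (f := fun w : Str => w) (h := fun _ (p : ℕ × Bool) => 2 * p.1 + p.2.toNat)
    Primrec.id (Primrec.const 0) ?_
  exact Primrec.nat_add.comp (Primrec.nat_mul.comp (Primrec.const 2)
    (Primrec.fst.comp Primrec.snd)) ((Primrec.dom_bool Bool.toNat).comp (Primrec.snd.comp Primrec.snd))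

theorem binPrefix_length (T : ℝ) (n : ℕ) : (binPrefix T n).length = n := by
  simp [binPrefix]

theorem strVal_binPrefix (T : ℝ) (n : ℕ) :
    (strVal (binPrefix T n) : ℤ) = ⌊Int.fract T * 2 ^ n⌋ := by
  induction n with
  | zero => simp [binPrefix, strVal]
  | succ n ih =>
    have h1 : binPrefix T (n + 1) = binPrefix T n ++
        [decide (⌊Int.fract T * 2 ^ (n + 1)⌋ % 2 = 1)] := by
      simp [binPrefix, List.range_succ]
    rw [h1, strVal, List.foldl_append]
    simp only [List.foldl_cons, List.foldl_nil]
    rw [strVal] at ih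
    push_cast
    rw [ih]
    set y := Int.fract T * 2 ^ n with hy
    have h2 : Int.fract T * 2 ^ (n + 1) = 2 * y := by rw [hy, pow_succ]; ring
    rw [h2]
    have h3 : (2 * ⌊y⌋ : ℤ) ≤ ⌊2 * y⌋ := by
      rw [Int.le_floor]; push_cast; linarith [Int.floor_le y]
    have h4 : ⌊2 * y⌋ < 2 * ⌊y⌋ + 2 := by
      rw [Int.floor_lt]; push_cast; linarith [Int.lt_floor_add_one y]
    by_cases h : ⌊2 * y⌋ % 2 = 1
    · simp [h]; omega
    · simp [h]; omega

/-- The halting test of the search. -/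
def condB (z : ℕ) (N : ℕ → ℕ) (w : Str) (k : ℕ) : Bool :=
  decide ((z * 2 ^ w.length + strVal w) * (k + 1) < N k * 2 ^ w.length + (k + 1))

theorem computable_condB (z : ℕ) {N : ℕ → ℕ} (hN : Computable N) :
    Computable (fun p : Str × ℕ => condB z N p.1 p.2) := by
  have hp : Primrec (fun p : (Str × ℕ) × ℕ => decide
      ((z * 2 ^ p.1.1.length + strVal p.1.1) * (p.1.2 + 1) <
        p.2 * 2 ^ p.1.1.length + (p.1.2 + 1))) := by
    have e1 : Primrec (fun p : (Str × ℕ) × ℕ => p.1.1) := Primrec.fst.comp Primrec.fst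
    have e2 : Primrec (fun p : (Str × ℕ) × ℕ => p.1.2 + 1) :=
      Primrec.succ.comp (Primrec.snd.comp Primrec.fst)
    have e3 : Primrec (fun p : (Str × ℕ) × ℕ => 2 ^ p.1.1.length) :=
      primrec_pow.comp (Primrec.const 2) (Primrec.list_length.comp e1)
    exact (Primrec.nat_lt.comp (Primrec.nat_mul.comp (Primrec.nat_add.comp
      (Primrec.nat_mul.comp (Primrec.const z) e3) (primrec_strVal.comp e1)) e2)
      (Primrec.nat_add.comp (Primrec.nat_mul.comp Primrec.snd e3) e2)).decide
  have h2 : Computable (fun p : Str × ℕ => (p, N p.2)) :=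
    Computable.id.pair (hN.comp Computable.snd)
  have h3 := hp.to_comp.comp h2
  exact h3.of_eq fun _ => rfl

theorem computable_termPow {f : ℕ → Str → ℚ} {g : ℕ → ℚ} (hfc : Computable₂ f)
    (hgc : Computable g) :
    Computable (fun z : (ℕ × ℕ) × Str => ratPow z.1.1 (f z.1.1 z.2) (g z.1.1)) := by
  have e1 : Computable (fun z : (ℕ × ℕ) × Str => z.1.1) := Computable.fst.comp Computable.fst
  have h2 : Computable (fun z : (ℕ × ℕ) × Str => f z.1.1 z.2) := hfc.comp e1 Computable.snd
  have h3 : Computable (fun z : (ℕ × ℕ) × Str => g z.1.1) := hgc.comp e1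
  have h : Computable (fun z : (ℕ × ℕ) × Str => (z.1.1, f z.1.1 z.2, g z.1.1)) :=
    e1.pair (h2.pair h3)
  have h4 := computable_ratPow.comp h
  exact h4.of_eq fun _ => rfl

attribute [irreducible] ratPow

set_option maxHeartbeats 2000000 in
theorem main_result (U : OptimalComputer)
    (m : Str → ℝ) (hm : UniversalProb m)
    (q : ℝ) (hq : 1 ≤ q) (hqr : RightComputableReal q) :
    Summable (fun s => m s ^ q) ∧
    LeftComputableReal (∑' s, m s ^ q) ∧
    ∃ c : ℕ, ∀ n : ℕ, (n : ℝ) / q - c ≤ Kc U (binPrefix (∑' s, m s ^ q) n) := by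
  obtain ⟨⟨⟨hm01, hmsum⟩, f, hfc, hf⟩, huniv⟩ := hm
  obtain ⟨g, hgc, hgq, hgt⟩ := hqr
  have hq0 : 0 < q := by linarith
  have hmq0 : ∀ s, 0 ≤ m s ^ q := fun s => Real.rpow_nonneg (hm01 s).1 q
  have hmq1 : ∀ s, m s ^ q ≤ m s := fun s => by
    have := Real.rpow_le_rpow_of_exponent_ge' (hm01 s).1 (hm01 s).2 zero_le_one hq
    simpa using this
  have hsumm : Summable m := summable_of_sum_le (fun s => (hm01 s).1) hmsum
  have hsum : Summable (fun s => m s ^ q) := Summable.of_nonneg_of_le hmq0 hmq1 hsumm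
  set T := ∑' s, m s ^ q with hT
  have hT0 : 0 ≤ T := tsum_nonneg hmq0
  -- the approximations
  have hg0 : ∀ k, 0 < g k := fun k => by
    have : (0 : ℝ) < g k := hq0.trans_le (hgq k)
    exact_mod_cast this
  have hterm0 : ∀ k s, (ratPow k (f k s) (g k) : ℝ) / (k + 1) ≤ (f k s : ℝ) ^ (g k : ℝ) :=
    fun k s => ratPow_le k _ _ ((hf s).1 k).1 (hg0 k)
  have hfm : ∀ k s, (f k s : ℝ) ^ (g k : ℝ) ≤ m s ^ q := by
    intro k s
    have h0 : (0 : ℝ) ≤ f k s := by exact_mod_cast ((hf s).1 k).1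
    calc (f k s : ℝ) ^ (g k : ℝ) ≤ m s ^ (g k : ℝ) :=
          Real.rpow_le_rpow h0 ((hf s).1 k).2 (by exact_mod_cast (hg0 k).le)
      _ ≤ m s ^ q := Real.rpow_le_rpow_of_exponent_ge' (hm01 s).1 (hm01 s).2 hq0.le (hgq k)
  have hlim : ∀ s, Tendsto (fun k => (ratPow k (f k s) (g k) : ℝ) / (k + 1)) atTop
      (𝓝 (m s ^ q)) := by
    intro s
    have h1 : Tendsto (fun k => (f k s : ℝ) ^ (g k : ℝ)) atTop (𝓝 (m s ^ q)) := by
      have := (Real.continuousAt_rpow (m s, q) (Or.inr hq0)).tendsto.comp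
        ((hf s).2.prodMk_nhds hgt)
      exact this
    have h2 : Tendsto (fun k : ℕ => (f k s : ℝ) ^ (g k : ℝ) - 1 / ((k : ℝ) + 1)) atTop
        (𝓝 (m s ^ q)) := by
      simpa using h1.sub tendsto_one_div_add_atTop_nhds_zero_nat
    refine tendsto_of_tendsto_of_tendsto_of_le_of_le h2 h1 (fun k => ?_) (fun k => hterm0 k s)
    refine (lt_ratPow k _ _ ((hf s).1 k).1 ?_ (hg0 k)).le
    have := ((hf s).1 k).2.trans (hm01 s).2
    exact_mod_cast this
  let J : ℕ → ℕ → ℕ := fun k i => Option.casesOn (decode₂ Str i) 0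
    (fun s => ratPow k (f k s) (g k))
  have hJ : Computable₂ J := by
    refine Computable.option_casesOn (o := fun p : ℕ × ℕ => decode₂ Str p.2) (f := fun _ => 0)
      (g := fun (p : ℕ × ℕ) s => ratPow p.1 (f p.1 s) (g p.1)) ?_ (Computable.const 0) ?_
    · exact Primrec.decode₂.to_comp.comp Computable.snd
    · exact computable_termPow hfc hgc
  let N : ℕ → ℕ := fun k => ∑ i ∈ Finset.range k, J k i
  have hN : Computable N := computable_sum Computable.id hJ
  have hNs : ∀ k, (N k : ℝ) / (k + 1) =
      ∑ s ∈ strBelow k, (ratPow k (f k s) (g k) : ℝ) / (k + 1) := by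
    intro k
    rw [← Finset.sum_div]
    congr 1
    have : N k = ∑ s ∈ strBelow k, ratPow k (f k s) (g k) := by
      show ∑ i ∈ Finset.range k, J k i = _
      rw [strBelow, ← Finset.sum_preimage (encode : Str → ℕ) (Finset.range k)
        encode_injective.injOn (J k)]
      · refine Finset.sum_congr rfl fun s _ => ?_
        simp only [J, decode₂_encode_str]
      · intro i _ hi
        simp only [J, decode₂_eq_none_of hi]
    rw [this]
    push_cast
    rfl
  have hNle : ∀ k, (N k : ℝ) / (k + 1) ≤ ∑ s ∈ strBelow k, m s ^ q := fun k => by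
    rw [hNs]
    exact Finset.sum_le_sum fun s _ => (hterm0 k s).trans (hfm k s)
  have hNT : ∀ k, (N k : ℝ) / (k + 1) ≤ T := fun k =>
    (hNle k).trans (hsum.sum_le_tsum _ fun s _ => hmq0 s)
  have hNlim : Tendsto (fun k => (N k : ℝ) / (k + 1)) atTop (𝓝 T) := by
    have h1 : ∀ k, (N k : ℝ) / (k + 1) =
        ∑' s, if s ∈ strBelow k then (ratPow k (f k s) (g k) : ℝ) / (k + 1) else 0 := by
      intro k
      rw [hNs, tsum_eq_sum (s := strBelow k) (fun s hs => if_neg hs)]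
      exact Finset.sum_congr rfl fun s hs => (if_pos hs).symm
    simp only [h1]
    refine tendsto_tsum_of_dominated_convergence hsum (fun s => ?_) (Eventually.of_forall ?_)
    · refine (hlim s).congr' ?_
      filter_upwards [eventually_gt_atTop (encode s)] with k hk
      rw [if_pos (mem_strBelow.2 hk)]
    · intro k s
      split_ifs
      · rw [Real.norm_of_nonneg (by positivity)]
        exact (hterm0 k s).trans (hfm k s)
      · simpa using hmq0 s
  clear_value N
  refine ⟨hsum, ?_, ?_⟩
  · refine ⟨fun k => -((N k : ℚ) / ((k + 1 : ℕ) : ℚ)), ?_, fun k => ?_, ?_⟩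
    · exact computable_ratNegDiv.comp hN Computable.id
    · have := hNT k
      push_cast
      linarith
    · have := hNlim.neg
      refine this.congr fun k => ?_
      push_cast
      rfl
  -- randomness
  let z : ℕ := ⌊T⌋₊
  have hz : (z : ℝ) + Int.fract T = T := by
    have h1 : ((⌊T⌋₊ : ℤ) : ℝ) = (⌊T⌋ : ℝ) := by
      exact_mod_cast congrArg (fun i : ℤ => (i : ℝ)) (Int.natCast_floor_eq_floor hT0)
    have h2 : (z : ℝ) = (⌊T⌋ : ℝ) := by simpa [z] using h1
    rw [h2]; exact Int.floor_add_fract T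
  let cond : Str → ℕ → Prop := fun w k => condB z N w k = true
  have hcdec : Computable₂ (fun (w : Str) (k : ℕ) => decide (cond w k)) := by
    refine Computable.of_eq (computable_condB z hN) fun p => ?_
    simp [cond]
  have hcond : ∀ w k, cond w k ↔
      (z : ℝ) + (strVal w : ℝ) / 2 ^ w.length - 1 / 2 ^ w.length < (N k : ℝ) / (k + 1) := by
    intro w k
    have hk : (0 : ℝ) < (k : ℝ) + 1 := by positivity
    have hw : (0 : ℝ) < (2 : ℝ) ^ w.length := by positivity
    have e : (z : ℝ) + (strVal w : ℝ) / 2 ^ w.length - 1 / 2 ^ w.length =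
      (z * 2 ^ w.length + strVal w - 1) / 2 ^ w.length := by field_simp
    rw [e, div_lt_div_iff₀ hw hk]
    have : cond w k ↔ ((z : ℝ) * 2 ^ w.length + strVal w) * (k + 1) <
        N k * 2 ^ w.length + (k + 1) := by
      simp only [cond, condB, decide_eq_true_eq]
      exact_mod_cast Iff.rfl
    rw [this]
    constructor <;> intro h <;> linarith
  let φ : Str →. Str := fun w => (Nat.rfind (fun k => Part.some (decide (cond w k)))).map
    (fun k => (List.range k).map (fun _ => true))
  have hφ : Partrec φ := by
    refine Partrec.map (Partrec.rfind (p := fun w k => Part.some (decide (cond w k))) ?_) ?_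
    · exact hcdec.partrec₂
    · apply Primrec.to_comp
      exact Primrec.list_map (Primrec.list_range.comp Primrec.snd) (Primrec.const true).to₂
  let ψ : Str →. Str := fun p => (U.f p).bind φ
  have hψ : Partrec ψ := U.partrec.bind (hφ.comp Computable.snd)
  obtain ⟨r, hr, hrψ⟩ := exists_output_semimeasure ψ hψ (fun p p' hp hp' hpp =>
    U.prefixFree p p' (Part.bind_dom.1 hp).1 (Part.bind_dom.1 hp').1 hpp)
  obtain ⟨c, hc0, hc⟩ := huniv r hr
  refine ⟨⌈1 - Real.logb 2 c⌉₊, fun n => ?_⟩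
  obtain ⟨p, hpl, hpU⟩ := Kc_attained U (binPrefix T n)
  rw [← hpl]
  set w := binPrefix T n with hw
  have hwl : w.length = n := binPrefix_length T n
  have hv := strVal_binPrefix T n
  rw [← hw] at hv
  have hv1 : (strVal w : ℝ) ≤ Int.fract T * 2 ^ n := by
    have := Int.floor_le (Int.fract T * 2 ^ n)
    rw [← hv] at this
    exact_mod_cast this
  have hv2 : Int.fract T * 2 ^ n < strVal w + 1 := by
    have := Int.lt_floor_add_one (Int.fract T * 2 ^ n)
    rw [← hv] at this
    exact_mod_cast this
  have h2n : (0 : ℝ) < 2 ^ n := by positivity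
  have hA1 : (z : ℝ) + (strVal w : ℝ) / 2 ^ n ≤ T := by
    have : (strVal w : ℝ) / 2 ^ n ≤ Int.fract T := by rwa [div_le_iff₀ h2n]
    linarith
  have hA2 : T < (z : ℝ) + (strVal w : ℝ) / 2 ^ n + 1 / 2 ^ n := by
    have : Int.fract T < (strVal w + 1 : ℝ) / 2 ^ n := by rwa [lt_div_iff₀ h2n]
    rw [add_div] at this
    linarith
  have hex : ∃ k, cond w k := by
    have hlt : (z : ℝ) + (strVal w : ℝ) / 2 ^ n - 1 / 2 ^ n < T := by
      have : (0 : ℝ) < 1 / 2 ^ n := by positivity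
      linarith
    obtain ⟨k, hk⟩ := (hNlim.eventually_const_lt hlt).exists
    exact ⟨k, (hcond w k).2 (by rwa [hwl])⟩
  obtain ⟨k0, hk0⟩ := hex
  obtain ⟨k, hk, -⟩ := Nat.rfind_min' (p := fun k => decide (cond w k)) (m := k0) (by simpa using hk0)
  have hkc : cond w k := by simpa using Nat.rfind_spec hk
  rw [hcond, hwl] at hkc
  set s : Str := (List.range k).map (fun _ => true) with hs
  have hsψ : s ∈ ψ p := Part.mem_bind hpU (Part.mem_map _ hk)
  have hsk : s ∉ strBelow k := by
    rw [mem_strBelow, not_lt]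
    have := length_le_encode s
    simpa [hs] using this
  have hms : m s ^ q + ∑ s ∈ strBelow k, m s ^ q ≤ T := by
    rw [← Finset.sum_insert (f := fun s => m s ^ q) hsk]
    exact hsum.sum_le_tsum _ fun s _ => hmq0 s
  have hms2 : m s ^ q ≤ 2 / 2 ^ n := by
    have := hNle k
    have e : (2 : ℝ) / 2 ^ n = 1 / 2 ^ n + 1 / 2 ^ n := by ring
    rw [e]
    linarith
  have hlow : c * (2 : ℝ)⁻¹ ^ p.length ≤ m s :=
    (mul_le_mul_of_nonneg_left (hrψ p s hsψ) hc0.le).trans (hc s)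
  have hpos : 0 < c * (2 : ℝ)⁻¹ ^ p.length := by positivity
  have hfin : (c * (2 : ℝ)⁻¹ ^ p.length) ^ q ≤ 2 / 2 ^ n :=
    (Real.rpow_le_rpow hpos.le hlow hq0.le).trans hms2
  have hlog := Real.logb_le_logb_of_le (b := 2) (by norm_num) (by positivity) hfin
  rw [Real.logb_rpow_eq_mul_logb_of_pos hpos, Real.logb_mul hc0.ne' (by positivity),
    Real.logb_div (by norm_num) (by positivity), Real.logb_pow, Real.logb_pow, Real.logb_inv,
    Real.logb_self_eq_one (by norm_num)] at hlog
  have hceil := Nat.le_ceil (1 - Real.logb 2 c)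
  have h3 : (n : ℝ) / q - 1 / q ≤ p.length - Real.logb 2 c := by
    rw [← sub_div, div_le_iff₀ hq0]
    linarith
  have h4 : 1 / q ≤ 1 := by rw [div_le_one hq0]; exact hq
  linarith

end Main

/-- For a universal probability `m` and a right-computable `q ≥ 1`, the power sum
`∑ s, m s ^ q` converges to a left-computable real which is weakly Chaitin
`1/q`-random. -/
theorem power_sum_left_computable_and_random (U : OptimalComputer)
    (m : Str → ℝ) (hm : UniversalProb m)
    (q : ℝ) (hq : 1 ≤ q) (hqr : RightComputableReal q) :
    Summable (fun s => m s ^ q) ∧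
    LeftComputableReal (∑' s, m s ^ q) ∧
    ∃ c : ℕ, ∀ n : ℕ, (n : ℝ) / q - c ≤ Kc U (binPrefix (∑' s, m s ^ q) n) := by
  exact main_result U m hm q hq hqr

end Paper
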